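/- Let γ : [0,1] → ℝ² be a C¹ curve with constant speed c > 0, normalized so that γ(0) = (0,0), and let θ be a turning angle function for γ with θ(0) = 0. If |θ(1) − θ(0)| ≥ 2π and ‖γ(1)‖ ≥ √(2(1 − cos θ(1))) · max_{s∈[0,1]} ‖γ(s)‖, then there exist cuts 0 ≤ c₁ ≤ c₂ ≤ 1 such that E(c₁,c₂) = (0,0), i.e., the rearranged curve r_{(c₁,c₂)} is closed (not necessarily with matching tangent directions at the closing point). -/

import Mathlib

/-- Counterclockwise rotation of the plane (identified with `ℂ`) about the origin
by angle `α`: `(x,y) ↦ (x cos α − y sin α, x sin α + y cos α)`. -/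
noncomputable def rot (α : ℝ) (v : ℂ) : ℂ :=
  ⟨v.re * Real.cos α - v.im * Real.sin α, v.re * Real.sin α + v.im * Real.cos α⟩

/-- Endpoint of the rearranged curve `r_{(c₁,c₂)}` (split `γ` at `c₁ ≤ c₂` and
concatenate the three arcs in the order first, third, second, matching tangent
directions at the junctions). -/
noncomputable def rearrEnd (γ : ℝ → ℂ) (θ : ℝ → ℝ) (c₁ c₂ : ℝ) : ℂ :=
  γ c₁ + rot (θ c₁ - θ c₂) (γ 1 - γ c₂) + rot (θ 1 - θ c₂) (γ c₂ - γ c₁)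

open scoped unitInterval in
lemma key_lift (H : I × I → ℂ) (hH : Continuous H) (h0 : ∀ x, H x ≠ 0) (w : ℂ)
    (hw0 : ∀ t, H (t, 0) = w) (hw1 : ∀ t, H (t, 1) = w) (hw2 : ∀ s, H (1, s) = w)
    (G : I → ℂ) (hG : Continuous G) (hGH : ∀ s, Complex.exp (G s) = H (0, s)) : G 0 = G 1 := by
  have cov := Complex.isCoveringMap_exp
  let H' : C(I × I, {z : ℂ // z ≠ 0}) := ⟨fun x => ⟨H x, h0 x⟩, by fun_prop⟩
  let G' : C(I, ℂ) := ⟨G, hG⟩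
  have hz : ∀ a, H' (0, a) = (fun z : ℂ ↦ (⟨_, z.exp_ne_zero⟩ : {z : ℂ // z ≠ 0})) (G' a) :=
    fun a => Subtype.ext (hGH a).symm
  let L := cov.liftHomotopy H' G' hz
  have hL : ∀ x, Complex.exp (L x) = H x := fun x =>
    congrArg Subtype.val (congrFun (cov.liftHomotopy_lifts H' G' hz) x)
  have hL0 : ∀ a, L (0, a) = G a := fun a => cov.liftHomotopy_zero H' G' hz a
  have e1 : L (0, 0) = L (1, 0) := cov.const_of_comp (g := fun t : I => L (t, 0)) (by fun_prop)
    (fun a a' => Subtype.ext (by simp only [hL, hw0])) 0 1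
  have e2 : L (1, 0) = L (1, 1) := cov.const_of_comp (g := fun t : I => L (1, t)) (by fun_prop)
    (fun a a' => Subtype.ext (by simp only [hL, hw2])) 0 1
  have e3 : L (0, 1) = L (1, 1) := cov.const_of_comp (g := fun t : I => L (t, 1)) (by fun_prop)
    (fun a a' => Subtype.ext (by simp only [hL, hw1])) 0 1
  rw [← hL0, ← hL0, e1, e2, e3]

lemma rot_eq (α : ℝ) (v : ℂ) : rot α v = Complex.exp (α * Complex.I) * v := by
  rw [Complex.exp_mul_I, ← Complex.ofReal_cos, ← Complex.ofReal_sin]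
  apply Complex.ext <;> simp [rot, -Complex.ofReal_cos, -Complex.ofReal_sin] <;> ring

lemma norm_exp_sub_one_eq (x : ℝ) :
    ‖Complex.exp (x * Complex.I) - 1‖ = Real.sqrt (2 * (1 - Real.cos x)) := by
  rw [Complex.norm_eq_sqrt_sq_add_sq]
  congr 1
  rw [Complex.exp_mul_I, ← Complex.ofReal_cos, ← Complex.ofReal_sin]
  simp [-Complex.ofReal_cos, -Complex.ofReal_sin]
  nlinarith [Real.sin_sq_add_cos_sq x]

/-- **Lemma with the ugly hypothesis.** If `γ : [0,1] → ℝ²` is a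
`C¹` curve of constant speed `c > 0` with `γ(0) = 0` and turning angle `θ` with
`θ(0) = 0`, and if `|θ(1) − θ(0)| ≥ 2π` and
`‖γ(1)‖ ≥ √(2(1 − cos θ(1))) · max_{s ∈ [0,1]} ‖γ(s)‖`, then there are cuts
`0 ≤ c₁ ≤ c₂ ≤ 1` with `E(c₁,c₂) = 0`, i.e. `r_{(c₁,c₂)}` is closed (not
necessarily smooth at the closing point). -/
theorem two_cut_closing_with_norm_hypothesis
    (γ : ℝ → ℂ) (θ : ℝ → ℝ) (c : ℝ) (hc : 0 < c)
    (hγ0 : γ 0 = 0) (hθ0 : θ 0 = 0)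
    (hθ : ContinuousOn θ (Set.Icc 0 1))
    (hderiv : ∀ s ∈ Set.Icc (0:ℝ) 1,
      HasDerivAt γ (c • (⟨Real.cos (θ s), Real.sin (θ s)⟩ : ℂ)) s)
    (hturn : |θ 1 - θ 0| ≥ 2 * Real.pi)
    (hnorm : ‖γ 1‖ ≥ Real.sqrt (2 * (1 - Real.cos (θ 1))) *
      sSup ((fun s => ‖γ s‖) '' Set.Icc (0:ℝ) 1)) :
    ∃ c₁ c₂ : ℝ, 0 ≤ c₁ ∧ c₁ ≤ c₂ ∧ c₂ ≤ 1 ∧ rearrEnd γ θ c₁ c₂ = 0 := by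
  have hγc : ContinuousOn γ (Set.Icc 0 1) :=
    fun s hs => (hderiv s hs).continuousAt.continuousWithinAt
  by_contra hcon
  push Not at hcon
  have hE : ∀ a b : ℝ, rearrEnd γ θ a b = γ a +
      Complex.exp ((θ a - θ b) * Complex.I) * (γ 1 - γ b) +
      Complex.exp ((θ 1 - θ b) * Complex.I) * (γ b - γ a) := by
    intro a b
    simp [rearrEnd, rot_eq]
  have hγ1 : γ 1 ≠ 0 := by
    have := hcon 0 0 le_rfl le_rfl zero_le_one
    rw [hE] at this
    simpa [hγ0] using this
  have hγI : Continuous (fun s : unitInterval => γ s) := hγc.domRestrict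
  have hθI : Continuous (fun s : unitInterval => θ s) := hθ.domRestrict
  let m : unitInterval × unitInterval → unitInterval := fun x => x.1 * x.2
  have hm : Continuous m := by fun_prop
  let H : unitInterval × unitInterval → ℂ := fun x => rearrEnd γ θ (m x) x.2
  have hHc : Continuous H := by
    have h1 : Continuous (fun x : unitInterval × unitInterval => γ (m x)) := hγI.comp hm
    have h2 : Continuous (fun x : unitInterval × unitInterval => θ (m x)) := hθI.comp hm
    have h3 : Continuous (fun x : unitInterval × unitInterval => γ x.2) := hγI.comp continuous_snd
    have h4 : Continuous (fun x : unitInterval × unitInterval => θ x.2) := hθI.comp continuous_snd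
    have h5 := Complex.continuous_ofReal.comp h2
    have h6 := Complex.continuous_ofReal.comp h4
    simp only [H, hE]
    exact (h1.add ((Complex.continuous_exp.comp ((h5.sub h6).mul continuous_const)).mul
      (continuous_const.sub h3))).add ((Complex.continuous_exp.comp
        ((continuous_const.sub h6).mul continuous_const)).mul (h3.sub h1))
  have hH0 : ∀ x, H x ≠ 0 := fun x =>
    hcon _ _ (m x).2.1 (by simpa [m] using mul_le_of_le_one_left x.2.2.1 x.1.2.2) x.2.2.2
  let e : ℂ := Complex.exp (θ 1 * Complex.I)
  let B : unitInterval → ℂ := fun s => 1 + (e - 1) * γ s / γ 1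
  have hBc : Continuous B := by
    exact continuous_const.add ((continuous_const.mul hγI).div_const _)
  have hH0s : ∀ s : unitInterval, H (0, s) = Complex.exp (-(θ s * Complex.I)) * (γ 1 * B s) := by
    intro s
    simp only [H, hE, m, B, e]
    have : Complex.exp ((θ 1 - θ s) * Complex.I)
        = Complex.exp (-(θ s * Complex.I)) * Complex.exp (θ 1 * Complex.I) := by
      rw [← Complex.exp_add]; ring_nf
    rw [this]
    simp [hγ0, hθ0]
    field_simp
    ring
  have hB0 : ∀ s, B s ≠ 0 := fun s h => hH0 (0, s) (by rw [hH0s, h]; simp)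
  have hBs : ∀ s, B s ∈ Complex.slitPlane := by
    intro s
    have hle : ‖(e - 1) * γ s / γ 1‖ ≤ 1 := by
      rw [norm_div, norm_mul, div_le_one (norm_pos_iff.2 hγ1), norm_exp_sub_one_eq]
      refine le_trans ?_ hnorm
      gcongr
      refine le_csSup ?_ ⟨s, s.2, rfl⟩
      exact (isCompact_Icc.image_of_continuousOn hγc.norm).bddAbove
    have hne := hB0 s
    simp only [B] at hne ⊢
    generalize (e - 1) * γ s / γ 1 = z at hle hne
    have h1 : z.re ^ 2 + z.im ^ 2 ≤ 1 := by
      have := Complex.sq_norm z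
      rw [Complex.normSq_apply] at this
      nlinarith [norm_nonneg z]
    left
    by_contra hneg
    simp at hneg
    have hre : z.re = -1 := by nlinarith [sq_nonneg z.im]
    have him : z.im = 0 := by
      rw [hre] at h1
      have : z.im ^ 2 = 0 := by nlinarith [sq_nonneg z.im]
      simpa using this
    apply hne
    apply Complex.ext <;> simp [hre, him]
  let G : unitInterval → ℂ := fun s => -(θ s * Complex.I) + (Complex.log (γ 1) + Complex.log (B s))
  have hGc : Continuous G := by
    have : Continuous fun s => Complex.log (B s) := hBc.clog hBs
    exact (((Complex.continuous_ofReal.comp hθI).mul continuous_const).neg).add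
      (continuous_const.add this)
  have hkey := key_lift H hHc hH0 (γ 1) (fun t => by simp [H, hE, m, hγ0])
    (fun t => by simp [H, hE, m]) (fun t => by simp [H, hE, m]) G hGc (fun s => by
      rw [hH0s]
      simp only [G]
      rw [Complex.exp_add, Complex.exp_add, Complex.exp_log hγ1, Complex.exp_log (hB0 s)])
  have hB1 : B 1 = e := by simp [B, hγ1]
  have hB00 : B 0 = 1 := by simp [B, hγ0]
  simp only [G, hB1, hB00] at hkey
  have him := congrArg Complex.im hkey
  simp [hθ0, Complex.log_im] at him
  have habs := Complex.abs_arg_le_pi e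
  rw [hθ0, sub_zero] at hturn
  have : Complex.arg e = θ 1 := by linarith
  rw [this] at habs
  linarith [Real.pi_pos]
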